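/- For every 2-player stage game G with |V₁^{m,p}| > 1 and |V₂^{m,p}| > 1: if G ∈ 𝒢_LS^{m,m} (local suboptimality occurs in some SPE of some G(T) when both players may use mixed strategies), then G ∈ 𝒢_LS^{m,p} (local suboptimality occurs in some SPE of some G(T) when player 1 may use mixed strategies and player 2 only pure strategies). -/

import Mathlib

open Finset

/-- A mixed strategy on a finite action set: a probability distribution. -/
structure Mix (A : Type*) [Fintype A] where
  p : A → ℝ
  nonneg : ∀ a, 0 ≤ p a
  sum_one : ∑ a, p a = 1

namespace Mix

/-- The Dirac (pure) mixed strategy at an action. -/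
def pure {A : Type*} [Fintype A] [DecidableEq A] (a : A) : Mix A where
  p := fun b => if b = a then 1 else 0
  nonneg := by intro b; by_cases hb : b = a <;> simp [hb]
  sum_one := by simp

/-- The support of a mixed strategy. -/
def support {A : Type*} [Fintype A] (σ : Mix A) : Set A := {a | 0 < σ.p a}

end Mix

section TwoPlayer

variable {A₁ A₂ : Type*} [Fintype A₁] [Fintype A₂] [DecidableEq A₁] [DecidableEq A₂]

/-- Expected payoff under a mixed strategy profile. -/
def expPay (u : A₁ → A₂ → ℝ) (σ₁ : Mix A₁) (σ₂ : Mix A₂) : ℝ :=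
  ∑ a₁, ∑ a₂, σ₁.p a₁ * σ₂.p a₂ * u a₁ a₂

/-- Player 1's pure action `a₁` is a best response among pure strategies to `a₂`. -/
def BR1p (u₁ : A₁ → A₂ → ℝ) (a₁ : A₁) (a₂ : A₂) : Prop := ∀ b₁, u₁ b₁ a₂ ≤ u₁ a₁ a₂

/-- Player 2's pure action `a₂` is a best response among pure strategies to `a₁`. -/
def BR2p (u₂ : A₁ → A₂ → ℝ) (a₁ : A₁) (a₂ : A₂) : Prop := ∀ b₂, u₂ a₁ b₂ ≤ u₂ a₁ a₂

/-- Player 1's mixed strategy `σ₁` is a best response (among mixed strategies) to `σ₂`. -/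
def BR1m (u₁ : A₁ → A₂ → ℝ) (σ₁ : Mix A₁) (σ₂ : Mix A₂) : Prop :=
  ∀ τ₁ : Mix A₁, expPay u₁ τ₁ σ₂ ≤ expPay u₁ σ₁ σ₂

/-- Player 2's mixed strategy `σ₂` is a best response (among mixed strategies) to `σ₁`. -/
def BR2m (u₂ : A₁ → A₂ → ℝ) (σ₁ : Mix A₁) (σ₂ : Mix A₂) : Prop :=
  ∀ τ₂ : Mix A₂, expPay u₂ σ₁ τ₂ ≤ expPay u₂ σ₁ σ₂

/-- Player 2's pure action `a₂` is a best response among pure strategies to mixed `σ₁`. -/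
def BR2pm (u₂ : A₁ → A₂ → ℝ) (σ₁ : Mix A₁) (a₂ : A₂) : Prop :=
  ∀ b₂ : A₂, expPay u₂ σ₁ (Mix.pure b₂) ≤ expPay u₂ σ₁ (Mix.pure a₂)

/-- Pure Nash equilibria (both players restricted to pure strategies). -/
def NashPP (u₁ u₂ : A₁ → A₂ → ℝ) : Set (A₁ × A₂) :=
  {q | BR1p u₁ q.1 q.2 ∧ BR2p u₂ q.1 q.2}

/-- Nash equilibria when player 1 is mixed and player 2 is pure. -/
def NashMP (u₁ u₂ : A₁ → A₂ → ℝ) : Set (Mix A₁ × A₂) :=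
  {q | BR1m u₁ q.1 (Mix.pure q.2) ∧ BR2pm u₂ q.1 q.2}

/-- Mixed Nash equilibria. -/
def NashMM (u₁ u₂ : A₁ → A₂ → ℝ) : Set (Mix A₁ × Mix A₂) :=
  {q | BR1m u₁ q.1 q.2 ∧ BR2m u₂ q.1 q.2}

def V1pp (u₁ u₂ : A₁ → A₂ → ℝ) : Set ℝ := (fun q => u₁ q.1 q.2) '' NashPP u₁ u₂
def V2pp (u₁ u₂ : A₁ → A₂ → ℝ) : Set ℝ := (fun q => u₂ q.1 q.2) '' NashPP u₁ u₂
def V1mp (u₁ u₂ : A₁ → A₂ → ℝ) : Set ℝ :=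
  (fun q => expPay u₁ q.1 (Mix.pure q.2)) '' NashMP u₁ u₂
def V2mp (u₁ u₂ : A₁ → A₂ → ℝ) : Set ℝ :=
  (fun q => expPay u₂ q.1 (Mix.pure q.2)) '' NashMP u₁ u₂
def V1mm (u₁ u₂ : A₁ → A₂ → ℝ) : Set ℝ := (fun q => expPay u₁ q.1 q.2) '' NashMM u₁ u₂
def V2mm (u₁ u₂ : A₁ → A₂ → ℝ) : Set ℝ := (fun q => expPay u₂ q.1 q.2) '' NashMM u₁ u₂

/-- The set `V` is a singleton, i.e. `|V| = 1`. -/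
def oneVal (V : Set ℝ) : Prop := ∃ v, V = {v}

/-- A history of play: a finite sequence of pure action profiles. -/
abbrev Hist (A₁ A₂ : Type*) := List (A₁ × A₂)

/-- A pure behavior strategy for player 1, seen as a mixed behavior strategy. -/
def pureBeh1 (μ : Hist A₁ A₂ → A₁) : Hist A₁ A₂ → Mix A₁ := fun h => Mix.pure (μ h)

/-- A pure behavior strategy for player 2, seen as a mixed behavior strategy. -/
def pureBeh2 (μ : Hist A₁ A₂ → A₂) : Hist A₁ A₂ → Mix A₂ := fun h => Mix.pure (μ h)

/-- Expected total payoff (w.r.t. `u`) over `T` remaining rounds, after history `h`. -/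
def totPay (u : A₁ → A₂ → ℝ) (μ₁ : Hist A₁ A₂ → Mix A₁) (μ₂ : Hist A₁ A₂ → Mix A₂) :
    ℕ → Hist A₁ A₂ → ℝ
  | 0, _ => 0
  | T + 1, h =>
      ∑ a₁, ∑ a₂, (μ₁ h).p a₁ * (μ₂ h).p a₂ * (u a₁ a₂ + totPay u μ₁ μ₂ T (h ++ [(a₁, a₂)]))

/-- The behavior strategy induced on the subgame following history `h`. -/
def condS {A₁ A₂ α : Type*} (μ : Hist A₁ A₂ → α) (h : Hist A₁ A₂) : Hist A₁ A₂ → α :=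
  fun h' => μ (h ++ h')

/-- Nash equilibrium of the `T`-round repeated game, both players mixed. -/
def isNEmm (u₁ u₂ : A₁ → A₂ → ℝ) (T : ℕ)
    (μ₁ : Hist A₁ A₂ → Mix A₁) (μ₂ : Hist A₁ A₂ → Mix A₂) : Prop :=
  (∀ μ₁' : Hist A₁ A₂ → Mix A₁, totPay u₁ μ₁' μ₂ T [] ≤ totPay u₁ μ₁ μ₂ T []) ∧
  (∀ μ₂' : Hist A₁ A₂ → Mix A₂, totPay u₂ μ₁ μ₂' T [] ≤ totPay u₂ μ₁ μ₂ T [])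

/-- Subgame-perfect equilibrium of the `T`-round repeated game, both players mixed. -/
def isSPEmm (u₁ u₂ : A₁ → A₂ → ℝ) (T : ℕ)
    (μ₁ : Hist A₁ A₂ → Mix A₁) (μ₂ : Hist A₁ A₂ → Mix A₂) : Prop :=
  ∀ h : Hist A₁ A₂, h.length < T → isNEmm u₁ u₂ (T - h.length) (condS μ₁ h) (condS μ₂ h)

/-- Nash equilibrium of the `T`-round repeated game, player 1 mixed and player 2 pure. -/
def isNEmp (u₁ u₂ : A₁ → A₂ → ℝ) (T : ℕ)
    (μ₁ : Hist A₁ A₂ → Mix A₁) (μ₂ : Hist A₁ A₂ → A₂) : Prop :=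
  (∀ μ₁' : Hist A₁ A₂ → Mix A₁,
      totPay u₁ μ₁' (pureBeh2 μ₂) T [] ≤ totPay u₁ μ₁ (pureBeh2 μ₂) T []) ∧
  (∀ μ₂' : Hist A₁ A₂ → A₂,
      totPay u₂ μ₁ (pureBeh2 μ₂') T [] ≤ totPay u₂ μ₁ (pureBeh2 μ₂) T [])

/-- SPE of the `T`-round repeated game, player 1 mixed and player 2 pure. -/
def isSPEmp (u₁ u₂ : A₁ → A₂ → ℝ) (T : ℕ)
    (μ₁ : Hist A₁ A₂ → Mix A₁) (μ₂ : Hist A₁ A₂ → A₂) : Prop :=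
  ∀ h : Hist A₁ A₂, h.length < T → isNEmp u₁ u₂ (T - h.length) (condS μ₁ h) (condS μ₂ h)

/-- Nash equilibrium of the `T`-round repeated game, both players pure. -/
def isNEpp (u₁ u₂ : A₁ → A₂ → ℝ) (T : ℕ)
    (μ₁ : Hist A₁ A₂ → A₁) (μ₂ : Hist A₁ A₂ → A₂) : Prop :=
  (∀ μ₁' : Hist A₁ A₂ → A₁,
      totPay u₁ (pureBeh1 μ₁') (pureBeh2 μ₂) T [] ≤
        totPay u₁ (pureBeh1 μ₁) (pureBeh2 μ₂) T []) ∧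
  (∀ μ₂' : Hist A₁ A₂ → A₂,
      totPay u₂ (pureBeh1 μ₁) (pureBeh2 μ₂') T [] ≤
        totPay u₂ (pureBeh1 μ₁) (pureBeh2 μ₂) T [])

/-- SPE of the `T`-round repeated game, both players pure. -/
def isSPEpp (u₁ u₂ : A₁ → A₂ → ℝ) (T : ℕ)
    (μ₁ : Hist A₁ A₂ → A₁) (μ₂ : Hist A₁ A₂ → A₂) : Prop :=
  ∀ h : Hist A₁ A₂, h.length < T → isNEpp u₁ u₂ (T - h.length) (condS μ₁ h) (condS μ₂ h)

/-- `G ∈ 𝒢_LS^{p,p}`: local suboptimality occurs in some SPE of some `G(T)`,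
both players restricted to pure strategies. -/
def GLSpp (u₁ u₂ : A₁ → A₂ → ℝ) : Prop :=
  ∃ T : ℕ, 1 ≤ T ∧ ∃ (μ₁ : Hist A₁ A₂ → A₁) (μ₂ : Hist A₁ A₂ → A₂),
    isSPEpp u₁ u₂ T μ₁ μ₂ ∧ ∃ h : Hist A₁ A₂, h.length < T ∧ (μ₁ h, μ₂ h) ∉ NashPP u₁ u₂

/-- `G ∈ 𝒢_LS^{m,p}`: local suboptimality occurs in some SPE of some `G(T)`,
player 1 mixed and player 2 pure. -/
def GLSmp (u₁ u₂ : A₁ → A₂ → ℝ) : Prop :=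
  ∃ T : ℕ, 1 ≤ T ∧ ∃ (μ₁ : Hist A₁ A₂ → Mix A₁) (μ₂ : Hist A₁ A₂ → A₂),
    isSPEmp u₁ u₂ T μ₁ μ₂ ∧ ∃ h : Hist A₁ A₂, h.length < T ∧ (μ₁ h, μ₂ h) ∉ NashMP u₁ u₂

/-- `G ∈ 𝒢_LS^{m,m}`: local suboptimality occurs in some SPE of some `G(T)`,
both players mixed. -/
def GLSmm (u₁ u₂ : A₁ → A₂ → ℝ) : Prop :=
  ∃ T : ℕ, 1 ≤ T ∧ ∃ (μ₁ : Hist A₁ A₂ → Mix A₁) (μ₂ : Hist A₁ A₂ → Mix A₂),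
    isSPEmm u₁ u₂ T μ₁ μ₂ ∧ ∃ h : Hist A₁ A₂, h.length < T ∧ (μ₁ h, μ₂ h) ∉ NashMM u₁ u₂

/-- The pure-pure characterization condition (condition of the pure-strategy theorem). -/
def condPP (u₁ u₂ : A₁ → A₂ → ℝ) : Prop :=
  ((V1pp u₁ u₂).Nontrivial ∧ (V2pp u₁ u₂).Nontrivial ∧
    ∃ (a₁ : A₁) (a₂ : A₂), (a₁, a₂) ∉ NashPP u₁ u₂) ∨
  ((V1pp u₁ u₂).Nontrivial ∧ oneVal (V2pp u₁ u₂) ∧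
    ∃ (a₁ a₁' : A₁) (a₂ : A₂), u₁ a₁ a₂ < u₁ a₁' a₂ ∧ BR2p u₂ a₁ a₂) ∨
  (oneVal (V1pp u₁ u₂) ∧ (V2pp u₁ u₂).Nontrivial ∧
    ∃ (a₁ : A₁) (a₂ a₂' : A₂), u₂ a₁ a₂ < u₂ a₁ a₂' ∧ BR1p u₁ a₁ a₂)

/-- The mixed-mixed characterization condition (condition of the general-case theorem). -/
def condMM (u₁ u₂ : A₁ → A₂ → ℝ) : Prop :=
  ((V1mm u₁ u₂).Nontrivial ∧ (V2mm u₁ u₂).Nontrivial ∧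
    ∃ (σ₁ : Mix A₁) (σ₂ : Mix A₂), (σ₁, σ₂) ∉ NashMM u₁ u₂) ∨
  ((V1mm u₁ u₂).Nontrivial ∧ oneVal (V2mm u₁ u₂) ∧
    ∃ (σ₁ : Mix A₁) (σ₂ : Mix A₂) (a₁' : A₁),
      expPay u₁ σ₁ σ₂ < expPay u₁ (Mix.pure a₁') σ₂ ∧ BR2m u₂ σ₁ σ₂) ∨
  (oneVal (V1mm u₁ u₂) ∧ (V2mm u₁ u₂).Nontrivial ∧
    ∃ (σ₁ : Mix A₁) (σ₂ : Mix A₂) (a₂' : A₂),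
      expPay u₂ σ₁ σ₂ < expPay u₂ σ₁ (Mix.pure a₂') ∧ BR1m u₁ σ₁ σ₂)

/-- The set `D` of differences of player 1's payoffs between pairs of stage-game
Nash equilibria (mixed-pure case). -/
def Dmp (u₁ u₂ : A₁ → A₂ → ℝ) : Set ℝ :=
  {x | ∃ q ∈ NashMP u₁ u₂, ∃ q' ∈ NashMP u₁ u₂,
    x = expPay u₁ q.1 (Mix.pure q.2) - expPay u₁ q'.1 (Mix.pure q'.2)}

/-- `x` is a finite (possibly empty) sum of elements of `D`. -/
def sumOfD (D : Set ℝ) (x : ℝ) : Prop :=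
  ∃ (n : ℕ) (d : Fin n → ℝ), (∀ k, d k ∈ D) ∧ x = ∑ k, d k

/-- The mixed-pure characterization condition (condition of the
pure-strategy-against-mixed-strategy theorem). -/
def condMP (u₁ u₂ : A₁ → A₂ → ℝ) : Prop :=
  ((V1mp u₁ u₂).Nontrivial ∧ (V2mp u₁ u₂).Nontrivial ∧
    ∃ (σ₁ : Mix A₁) (a₂ : A₂), (σ₁, a₂) ∉ NashMP u₁ u₂) ∨
  ((V1mp u₁ u₂).Nontrivial ∧ oneVal (V2mp u₁ u₂) ∧
    ∃ (σ₁ : Mix A₁) (a₁' : A₁) (a₂ : A₂),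
      expPay u₁ σ₁ (Mix.pure a₂) < u₁ a₁' a₂ ∧
      BR2pm u₂ σ₁ a₂ ∧
      (σ₁.support.Nontrivial →
        ∃ a ∈ σ₁.support, ∀ a' ∈ σ₁.support, a' ≠ a →
          sumOfD (Dmp u₁ u₂) (u₁ a a₂ - u₁ a' a₂))) ∨
  (oneVal (V1mp u₁ u₂) ∧ (V2mp u₁ u₂).Nontrivial ∧
    ∃ (σ₁ : Mix A₁) (a₂ a₂' : A₂),
      expPay u₂ σ₁ (Mix.pure a₂) < expPay u₂ σ₁ (Mix.pure a₂') ∧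
      BR1m u₁ σ₁ (Mix.pure a₂))

/-- A history is reachable under the behavior profile `(μ₁, μ₂)` (mixed-pure case):
every action of player 1 along it has positive probability and every action of
player 2 along it is the prescribed one. -/
def reachableMP (μ₁ : Hist A₁ A₂ → Mix A₁) (μ₂ : Hist A₁ A₂ → A₂) (h : Hist A₁ A₂) : Prop :=
  ∀ k : Fin h.length, 0 < (μ₁ (h.take k.val)).p (h.get k).1 ∧ μ₂ (h.take k.val) = (h.get k).2

end TwoPlayer

section Trigger

variable {A₁ A₂ : Type*} [Fintype A₁] [Fintype A₂]

theorem sum_mix_const (σ₁ : Mix A₁) (σ₂ : Mix A₂) (C : ℝ) :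
    ∑ a₁, ∑ a₂, σ₁.p a₁ * σ₂.p a₂ * C = C := by
  simp_rw [← Finset.sum_mul, ← Finset.mul_sum, σ₂.sum_one, mul_one, σ₁.sum_one, one_mul]

theorem sum_mix_le (σ₁ : Mix A₁) (σ₂ : Mix A₂) {X Y : A₁ → A₂ → ℝ} (h : ∀ a b, X a b ≤ Y a b) :
    ∑ a₁, ∑ a₂, σ₁.p a₁ * σ₂.p a₂ * X a₁ a₂ ≤ ∑ a₁, ∑ a₂, σ₁.p a₁ * σ₂.p a₂ * Y a₁ a₂ :=
  Finset.sum_le_sum fun a _ => Finset.sum_le_sum fun b _ =>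
    mul_le_mul_of_nonneg_left (h a b) (mul_nonneg (σ₁.nonneg a) (σ₂.nonneg b))

theorem totPay_succ (u : A₁ → A₂ → ℝ) (μ₁ : Hist A₁ A₂ → Mix A₁) (μ₂ : Hist A₁ A₂ → Mix A₂)
    (T : ℕ) (h : Hist A₁ A₂) :
    totPay u μ₁ μ₂ (T + 1) h =
      expPay (fun a₁ a₂ => u a₁ a₂ + totPay u μ₁ μ₂ T (h ++ [(a₁, a₂)])) (μ₁ h) (μ₂ h) :=
  rfl

theorem totPay_append (u : A₁ → A₂ → ℝ) (μ₁ : Hist A₁ A₂ → Mix A₁) (μ₂ : Hist A₁ A₂ → Mix A₂)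
    (T : ℕ) (h h' : Hist A₁ A₂) :
    totPay u μ₁ μ₂ T (h ++ h') = totPay u (condS μ₁ h) (condS μ₂ h) T h' := by
  induction T generalizing h' with
  | zero => rfl
  | succ T ih => simp only [totPay, List.append_assoc, ih, condS]

theorem totPay_neg (u : A₁ → A₂ → ℝ) (μ₁ : Hist A₁ A₂ → Mix A₁) (μ₂ : Hist A₁ A₂ → Mix A₂)
    (T : ℕ) (h : Hist A₁ A₂) :
    totPay (fun a b => -u a b) μ₁ μ₂ T h = -totPay u μ₁ μ₂ T h := by
  induction T generalizing h with
  | zero => simp [totPay]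
  | succ T ih => simp only [totPay, ih, ← neg_add, mul_neg, Finset.sum_neg_distrib]

theorem totPay_le_sum {u : A₁ → A₂ → ℝ} {μ₁ : Hist A₁ A₂ → Mix A₁} {μ₂ : Hist A₁ A₂ → Mix A₂}
    {v : ℕ → ℝ} (hv : ∀ h, expPay u (μ₁ h) (μ₂ h) ≤ v h.length) (T : ℕ) (h : Hist A₁ A₂) :
    totPay u μ₁ μ₂ T h ≤ ∑ i ∈ range T, v (h.length + i) := by
  induction T generalizing h with
  | zero => simp [totPay]
  | succ T ih =>
    have hle := sum_mix_le (μ₁ h) (μ₂ h) fun a b => ih (h ++ [(a, b)])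
    simp only [List.length_append, List.length_singleton, add_assoc] at hle
    rw [sum_mix_const] at hle
    have hstage := hv h
    simp only [expPay] at hstage
    simp only [totPay, mul_add, Finset.sum_add_distrib]
    rw [Finset.sum_range_succ']
    simp only [add_comm _ 1, add_zero]
    linarith

theorem totPay_eq_sum {u : A₁ → A₂ → ℝ} {μ₁ : Hist A₁ A₂ → Mix A₁} {μ₂ : Hist A₁ A₂ → Mix A₂}
    {v : ℕ → ℝ} (hv : ∀ h, expPay u (μ₁ h) (μ₂ h) = v h.length) (T : ℕ) (h : Hist A₁ A₂) :
    totPay u μ₁ μ₂ T h = ∑ i ∈ range T, v (h.length + i) := by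
  refine le_antisymm (totPay_le_sum (fun h => (hv h).le) T h) ?_
  have hneg := totPay_le_sum (u := fun a b => -u a b) (μ₁ := μ₁) (μ₂ := μ₂) (v := fun n => -v n)
    (fun h => by simp [expPay, ← hv h]) T h
  rw [totPay_neg, Finset.sum_neg_distrib] at hneg
  linarith

theorem sum_range_two_phase (x y : ℝ) (N : ℕ) :
    ∑ i ∈ range (N + N), (if i < N then x else y) = N * x + N * y := by
  rw [Finset.sum_range_add, Finset.sum_congr rfl fun i hi => if_pos (Finset.mem_range.mp hi)]
  simp

theorem eventually_forall_add_mul_le {ι : Type*} [Finite ι] (g : ι → ℝ) (c : ℝ) {x y : ℝ}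
    (hxy : x < y) : ∀ᶠ N : ℕ in Filter.atTop, ∀ i, g i + N * x ≤ c + N * y := by
  rw [Filter.eventually_all]
  intro i
  have ht := (tendsto_natCast_atTop_atTop (R := ℝ)).atTop_mul_const (sub_pos.mpr hxy)
  filter_upwards [ht.eventually_ge_atTop (g i - c)] with N hN
  linarith

/-- Play `x` in the first round; afterwards play according to `f c`, where `c` is the profile
realized in the first round, depending only on the number of rounds since then. -/
def trigger {α : Type*} (x : α) (f : A₁ × A₂ → ℕ → α) : Hist A₁ A₂ → α
  | [] => x
  | c :: t => f c t.length

variable [DecidableEq A₂]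

theorem expPay_le_of_forall_le_left {X : A₁ → A₂ → ℝ} {C : ℝ} {b : A₂} (σ : Mix A₁)
    (h : ∀ a, X a b ≤ C) : expPay X σ (Mix.pure b) ≤ C := by
  calc expPay X σ (Mix.pure b) = ∑ a, σ.p a * X a b := by simp [expPay, Mix.pure]
    _ ≤ ∑ a, σ.p a * C :=
      Finset.sum_le_sum fun a _ => mul_le_mul_of_nonneg_left (h a) (σ.nonneg a)
    _ = C := by rw [← Finset.sum_mul, σ.sum_one, one_mul]

variable [DecidableEq A₁]

@[simp]
theorem expPay_pure_pure (u : A₁ → A₂ → ℝ) (a₁ : A₁) (a₂ : A₂) :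
    expPay u (Mix.pure a₁) (Mix.pure a₂) = u a₁ a₂ := by
  simp [expPay, Mix.pure]

/-- If every pure profile is an equilibrium, then so is every mixed profile. -/
theorem mem_NashMM_of_forall_pure {u₁ u₂ : A₁ → A₂ → ℝ}
    (h : ∀ a₁ a₂, (Mix.pure a₁, a₂) ∈ NashMP u₁ u₂) (q : Mix A₁ × Mix A₂) :
    q ∈ NashMM u₁ u₂ := by
  have h₁ (a b : A₁) (c : A₂) : u₁ b c ≤ u₁ a c := by
    simpa using (h a c).1 (Mix.pure b)
  have h₂ (a : A₁) (c d : A₂) : u₂ a d ≤ u₂ a c := by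
    simpa using (h a c).2 d
  constructor
  · intro τ
    have key (σ : Mix A₁) (a : A₁) :
        expPay u₁ σ q.2 = ∑ c, q.2.p c * u₁ a c := by
      have : expPay u₁ σ q.2 = ∑ b, σ.p b * ∑ c, q.2.p c * u₁ a c := by
        simp only [expPay, Finset.mul_sum]
        refine Finset.sum_congr rfl fun b _ => Finset.sum_congr rfl fun c _ => ?_
        rw [le_antisymm (h₁ a b c) (h₁ b a c), mul_assoc]
      rw [this, ← Finset.sum_mul, σ.sum_one, one_mul]
    rcases isEmpty_or_nonempty A₁ with hA | ⟨⟨a⟩⟩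
    · simp [expPay]
    · rw [key τ a, key q.1 a]
  · intro τ
    refine Finset.sum_le_sum fun a _ => ?_
    rcases isEmpty_or_nonempty A₂ with hA | ⟨⟨c⟩⟩
    · simp
    · have key (σ : Mix A₂) : ∑ d, q.1.p a * σ.p d * u₂ a d = q.1.p a * u₂ a c := by
        calc ∑ d, q.1.p a * σ.p d * u₂ a d = ∑ d, σ.p d * (q.1.p a * u₂ a c) := by
              refine Finset.sum_congr rfl fun d _ => ?_
              rw [le_antisymm (h₂ a c d) (h₂ a d c)]
              ring
          _ = q.1.p a * u₂ a c := by rw [← Finset.sum_mul, σ.sum_one, one_mul]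
      rw [key, key]

/-- A pure first-round profile followed by stage equilibria selected by the first-round outcome
is subgame perfect as soon as no player gains by a first-round deviation. -/
theorem isSPEmp_trigger {u₁ u₂ : A₁ → A₂ → ℝ} {a₁ : A₁} {a₂ : A₂}
    {f : A₁ × A₂ → ℕ → Mix A₁ × A₂} (hf : ∀ c n, f c n ∈ NashMP u₁ u₂) (T : ℕ)
    (h₁ : ∀ b, u₁ b a₂ + ∑ i ∈ range T, expPay u₁ (f (b, a₂) i).1 (Mix.pure (f (b, a₂) i).2) ≤
      u₁ a₁ a₂ + ∑ i ∈ range T, expPay u₁ (f (a₁, a₂) i).1 (Mix.pure (f (a₁, a₂) i).2))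
    (h₂ : ∀ b, u₂ a₁ b + ∑ i ∈ range T, expPay u₂ (f (a₁, b) i).1 (Mix.pure (f (a₁, b) i).2) ≤
      u₂ a₁ a₂ + ∑ i ∈ range T, expPay u₂ (f (a₁, a₂) i).1 (Mix.pure (f (a₁, a₂) i).2)) :
    isSPEmp u₁ u₂ (T + 1) (trigger (Mix.pure a₁) fun c n => (f c n).1)
      (trigger a₂ fun c n => (f c n).2) := by
  set μ₁ : Hist A₁ A₂ → Mix A₁ := trigger (Mix.pure a₁) fun c n => (f c n).1 with hμ₁
  set μ₂ : Hist A₁ A₂ → A₂ := trigger a₂ fun c n => (f c n).2 with hμ₂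
  have play (u : A₁ → A₂ → ℝ) (c : A₁ × A₂) (t : Hist A₁ A₂) (n : ℕ) :
      totPay u (condS μ₁ (c :: t)) (condS (pureBeh2 μ₂) (c :: t)) n [] =
        ∑ i ∈ range n, expPay u (f c (t.length + i)).1 (Mix.pure (f c (t.length + i)).2) := by
    rw [totPay_eq_sum
      (v := fun i => expPay u (f c (t.length + i)).1 (Mix.pure (f c (t.length + i)).2))]
    · simp
    · intro h
      simp [condS, pureBeh2, hμ₁, hμ₂, trigger]
  have dev₁ (ν : Hist A₁ A₂ → Mix A₁) (c : A₁ × A₂) (t : Hist A₁ A₂) (n : ℕ) :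
      totPay u₁ ν (condS (pureBeh2 μ₂) (c :: t)) n [] ≤
        ∑ i ∈ range n, expPay u₁ (f c (t.length + i)).1 (Mix.pure (f c (t.length + i)).2) := by
    have := totPay_le_sum (u := u₁) (μ₁ := ν) (μ₂ := condS (pureBeh2 μ₂) (c :: t))
      (v := fun i => expPay u₁ (f c (t.length + i)).1 (Mix.pure (f c (t.length + i)).2))
      (fun h => by
        simpa [condS, pureBeh2, hμ₂, trigger] using (hf c (t.length + h.length)).1 (ν h)) n []
    simpa using this
  have dev₂ (ν : Hist A₁ A₂ → A₂) (c : A₁ × A₂) (t : Hist A₁ A₂) (n : ℕ) :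
      totPay u₂ (condS μ₁ (c :: t)) (pureBeh2 ν) n [] ≤
        ∑ i ∈ range n, expPay u₂ (f c (t.length + i)).1 (Mix.pure (f c (t.length + i)).2) := by
    have := totPay_le_sum (u := u₂) (μ₁ := condS μ₁ (c :: t)) (μ₂ := pureBeh2 ν)
      (v := fun i => expPay u₂ (f c (t.length + i)).1 (Mix.pure (f c (t.length + i)).2))
      (fun h => by
        simpa [condS, pureBeh2, hμ₁, trigger] using (hf c (t.length + h.length)).2 (ν h)) n []
    simpa using this
  have root (u : A₁ → A₂ → ℝ) : totPay u μ₁ (pureBeh2 μ₂) (T + 1) [] =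
      u a₁ a₂ + ∑ i ∈ range T, expPay u (f (a₁, a₂) i).1 (Mix.pure (f (a₁, a₂) i).2) := by
    have hplay := play u (a₁, a₂) [] T
    rw [← totPay_append] at hplay
    rw [totPay_succ, show μ₁ [] = Mix.pure a₁ from rfl,
      show pureBeh2 μ₂ [] = Mix.pure a₂ from rfl, expPay_pure_pure]
    simpa using hplay
  rintro (_ | ⟨c, t⟩) -
  · change isNEmp u₁ u₂ (T + 1) μ₁ μ₂
    constructor
    · intro ν
      rw [root, totPay_succ, show pureBeh2 μ₂ [] = Mix.pure a₂ from rfl]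
      refine expPay_le_of_forall_le_left _ fun b => le_trans ?_ (h₁ b)
      have hdev := dev₁ (condS ν [(b, a₂)]) (b, a₂) [] T
      rw [← totPay_append] at hdev
      simpa using hdev
    · intro ν
      rw [root, totPay_succ, show μ₁ [] = Mix.pure a₁ from rfl,
        show pureBeh2 ν [] = Mix.pure (ν []) from rfl, expPay_pure_pure]
      refine le_trans ?_ (h₂ (ν []))
      have hdev := dev₂ (condS ν [(a₁, ν [])]) (a₁, ν []) [] T
      rw [show pureBeh2 (condS ν [(a₁, ν [])]) = condS (pureBeh2 ν) [(a₁, ν [])] from rfl,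
        ← totPay_append] at hdev
      simpa using hdev
  · exact ⟨fun ν => (dev₁ ν c t _).trans (play u₁ c t _).ge,
      fun ν => (dev₂ ν c t _).trans (play u₂ c t _).ge⟩

/-- With two distinct equilibrium payoffs for each player, any pure profile that is not a stage
equilibrium can be enforced in the first round. -/
theorem GLSmp_of_pure_notMem_NashMP {u₁ u₂ : A₁ → A₂ → ℝ} (hV1 : (V1mp u₁ u₂).Nontrivial)
    (hV2 : (V2mp u₁ u₂).Nontrivial) {a₁ : A₁} {a₂ : A₂}
    (ha : (Mix.pure a₁, a₂) ∉ NashMP u₁ u₂) : GLSmp u₁ u₂ := by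
  obtain ⟨-, ⟨p, hp, rfl⟩, -, ⟨q, hq, rfl⟩, hpq⟩ := hV1.exists_lt
  obtain ⟨-, ⟨r, hr, rfl⟩, -, ⟨s, hs, rfl⟩, hrs⟩ := hV2.exists_lt
  obtain ⟨N, hN₁, hN₂⟩ := ((eventually_forall_add_mul_le (u₁ · a₂) (u₁ a₁ a₂) hpq).and
    (eventually_forall_add_mul_le (u₂ a₁ ·) (u₂ a₁ a₂) hrs)).exists
  let f : A₁ × A₂ → ℕ → Mix A₁ × A₂ := fun c n =>
    if n < N then (if c.1 = a₁ then q else p) else (if c.2 = a₂ then s else r)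
  have hf (c n) : f c n ∈ NashMP u₁ u₂ := by
    dsimp only [f]
    split_ifs <;> assumption
  have hsum (u : A₁ → A₂ → ℝ) (c : A₁ × A₂) :
      ∑ i ∈ range (N + N), expPay u (f c i).1 (Mix.pure (f c i).2) =
        N * (if c.1 = a₁ then expPay u q.1 (Mix.pure q.2) else expPay u p.1 (Mix.pure p.2)) +
        N * (if c.2 = a₂ then expPay u s.1 (Mix.pure s.2) else expPay u r.1 (Mix.pure r.2)) := by
    rw [← sum_range_two_phase]
    refine Finset.sum_congr rfl fun i _ => ?_
    dsimp only [f]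
    split_ifs <;> rfl
  refine ⟨N + N + 1, by omega, _, _, isSPEmp_trigger (a₁ := a₁) (a₂ := a₂) hf (N + N) ?_ ?_,
    [], by simp, ha⟩
  · intro b
    rw [hsum, hsum]
    by_cases hb : b = a₁
    · simp [hb]
    · simp only [hb, if_true, if_false]
      linarith [hN₁ b]
  · intro b
    rw [hsum, hsum]
    by_cases hb : b = a₂
    · simp [hb]
    · simp only [hb, if_true, if_false]
      linarith [hN₂ b]

end Trigger

section TwoPlayer
variable {A₁ A₂ : Type*} [Fintype A₁] [Fintype A₂] [DecidableEq A₁] [DecidableEq A₂]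
variable [Nonempty A₁] [Nonempty A₂]

/-- If `|V₁^{m,p}| > 1`, `|V₂^{m,p}| > 1`, and `G ∈ 𝒢_LS^{m,m}`, then `G ∈ 𝒢_LS^{m,p}`. -/
theorem GLSmp_of_GLSmm (u₁ u₂ : A₁ → A₂ → ℝ)
    (hV1 : (V1mp u₁ u₂).Nontrivial) (hV2 : (V2mp u₁ u₂).Nontrivial)
    (h : GLSmm u₁ u₂) : GLSmp u₁ u₂ := by
  obtain ⟨T, -, μ₁, μ₂, -, k, -, hk⟩ := h
  by_cases hall : ∀ a₁ a₂, (Mix.pure a₁, a₂) ∈ NashMP u₁ u₂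
  · exact absurd (mem_NashMM_of_forall_pure hall _) hk
  · push Not at hall
    obtain ⟨a₁, a₂, ha⟩ := hall
    exact GLSmp_of_pure_notMem_NashMP hV1 hV2 ha

end TwoPlayer
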